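/- Given the sℓ×N matrix R_{a,b}, the following are equivalent: (a) rank R_{a,b} = N; (b) there exists an r×sℓ matrix S with S R_{a,b} = (I_r, 0_{r×(N−r)}); (c) there exist c_j ∈ A_a, j=1,...,s, such that {T^{rn} c_j}_{j=1..s, n=0..ℓ−1} is a frame (spanning set) for A_a and every x ∈ A_a satisfies x = Σ_{j=1}^s Σ_{n=0}^{ℓ−1} L_j x(rn) T^{rn} c_j; (d) there exists a frame {C_{j,n}} for A_a with x = Σ_j Σ_n L_j x(rn) C_{j,n} for all x ∈ A_a. -/

import Mathlib

open scoped ComplexInnerProductSpace ComplexConjugate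

theorem ContinuousLinearEquiv.zpow_apply_add {H : Type*} [NormedAddCommGroup H]
    [InnerProductSpace ℂ H] (T : H ≃L[ℂ] H) (m n : ℤ) (x : H) :
    (T ^ m) ((T ^ n) x) = (T ^ (m + n)) x := by
  rw [zpow_add]; rfl

/-- If `S` is adjoint to `T`, then `S ^ m` is adjoint to `T ^ m` for every integer `m`. -/
theorem inner_zpow_apply_eq {H : Type*} [NormedAddCommGroup H] [InnerProductSpace ℂ H]
    {T S : H ≃L[ℂ] H} (hS : ∀ x y : H, ⟪T x, y⟫ = ⟪x, S y⟫) (m : ℤ) (x y : H) :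
    ⟪(T ^ m) x, y⟫ = ⟪x, (S ^ m) y⟫ := by
  induction m generalizing x y with
  | zero => rfl
  | succ n ih =>
    rw [add_comm, ← ContinuousLinearEquiv.zpow_apply_add, zpow_one, hS, ih, add_comm,
      ← ContinuousLinearEquiv.zpow_apply_add, zpow_one]
  | pred n ih =>
    have hT : x = T ((T ^ (-1 : ℤ)) x) := by
      have := T.zpow_apply_add 1 (-1) x
      rw [zpow_one] at this
      exact this.symm
    have hS' : (S ^ (-(n : ℤ))) y = S ((S ^ (-(n : ℤ) - 1)) y) := by
      have := S.zpow_apply_add 1 (-(n : ℤ) - 1) y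
      rw [zpow_one] at this
      rw [this]; congr 2; ring
    have hT' : (T ^ (-(n : ℤ) - 1)) x = (T ^ (-(n : ℤ))) ((T ^ (-1 : ℤ)) x) := by
      rw [T.zpow_apply_add]; rfl
    rw [hT', ih, hS', ← hS, ← hT]

/-- The sum of a periodic function over a period does not depend on the starting point. -/
theorem Function.Periodic.sum_range_add {M : Type*} [AddCommGroup M] {f : ℤ → M} {l : ℕ}
    (hf : Function.Periodic f (l : ℤ)) (m : ℤ) :
    ∑ n ∈ Finset.range l, f (n + m) = ∑ n ∈ Finset.range l, f n := by
  have step (t : ℤ) :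
      ∑ n ∈ Finset.range l, f (n + (t + 1)) = ∑ n ∈ Finset.range l, f (n + t) := by
    have h := (Finset.sum_range_succ (fun n : ℕ => f (n + t)) l).symm.trans
      (Finset.sum_range_succ' (fun n : ℕ => f (n + t)) l)
    have hl : f (l + t) = f t := by rw [add_comm, hf]
    simp only [hl, Nat.cast_zero, zero_add, add_left_inj] at h
    rw [h]
    refine Finset.sum_congr rfl fun n _ => ?_
    push_cast
    congr 1; ring
  induction m with
  | zero => simp
  | succ n ih => rw [step, ih]
  | pred n ih => rw [← ih, ← step]; simp

theorem Matrix.exists_mul_eq_one_of_rank_eq {m n K : Type*} [Fintype m] [Fintype n]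
    [DecidableEq m] [DecidableEq n] [Field K] {A : Matrix m n K} (h : A.rank = Fintype.card n) :
    ∃ B : Matrix n m K, B * A = 1 := by
  have hker : LinearMap.ker A.mulVecLin = ⊥ := by
    have := A.mulVecLin.finrank_range_add_finrank_ker
    rw [← Matrix.rank, h, Module.finrank_fintype_fun_eq_card] at this
    exact Submodule.finrank_eq_zero.mp (by omega)
  obtain ⟨g, hg⟩ := LinearMap.exists_leftInverse_of_injective _ hker
  refine ⟨LinearMap.toMatrix' g, ?_⟩
  have := congrArg LinearMap.toMatrix' hg
  rwa [LinearMap.toMatrix'_comp, LinearMap.toMatrix'_id, ← Matrix.toLin'_apply',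
    LinearMap.toMatrix'_toLin'] at this

theorem Matrix.rank_eq_card_of_mulVec_eq_zero {m n K : Type*} [Fintype m] [Fintype n]
    [Field K] {A : Matrix m n K} (h : ∀ v, A.mulVec v = 0 → v = 0) :
    A.rank = Fintype.card n := by
  have hker : LinearMap.ker A.mulVecLin = ⊥ := LinearMap.ker_eq_bot'.mpr h
  have := A.mulVecLin.finrank_range_add_finrank_ker
  rw [hker, finrank_bot, Module.finrank_fintype_fun_eq_card] at this
  exact this

section Orbit

variable {H : Type*} [NormedAddCommGroup H] [InnerProductSpace ℂ H] {T : H ≃L[ℂ] H} {N : ℕ} {a : H}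

theorem zpow_apply_periodic (hTN : (T ^ N) a = a) :
    Function.Periodic (fun k : ℤ => (T ^ k) a) (N : ℤ) := fun k => by
  change (T ^ (k + (N : ℤ))) a = (T ^ k) a
  rw [← T.zpow_apply_add, zpow_natCast, hTN]

theorem zpow_apply_mem_span (hN : 0 < N) (hTN : (T ^ N) a = a) (k : ℤ) :
    (T ^ k) a ∈ Submodule.span ℂ (Set.range fun k : Fin N => (T ^ (k : ℕ)) a) := by
  have hN' : (0 : ℤ) < N := by exact_mod_cast hN
  have h0 := Int.emod_nonneg k hN'.ne'
  have h1 := Int.emod_lt_of_pos k hN'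
  refine Submodule.subset_span ⟨⟨(k % N).toNat, by omega⟩, ?_⟩
  change (T ^ (k % (N : ℤ)).toNat) a = (T ^ k) a
  rw [← zpow_natCast, Int.toNat_of_nonneg h0]
  have h := (zpow_apply_periodic hTN).int_mul (k / N) (k % N)
  rw [← h]
  congr 2
  linear_combination Int.emod_add_mul_ediv k N

theorem zpow_apply_mem_of_mem_span (hN : 0 < N) (hTN : (T ^ N) a = a) (m : ℤ) {x : H}
    (hx : x ∈ Submodule.span ℂ (Set.range fun k : Fin N => (T ^ (k : ℕ)) a)) :
    (T ^ m) x ∈ Submodule.span ℂ (Set.range fun k : Fin N => (T ^ (k : ℕ)) a) := by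
  induction hx using Submodule.span_induction with
  | mem x h =>
    obtain ⟨k, rfl⟩ := h
    change (T ^ m) ((T ^ (k : ℕ)) a) ∈ _
    rw [← zpow_natCast T k, T.zpow_apply_add]
    exact zpow_apply_mem_span hN hTN _
  | zero => rw [map_zero]; exact zero_mem _
  | add x y _ _ hx hy => rw [map_add]; exact add_mem hx hy
  | smul c x _ hx => rw [map_smul]; exact Submodule.smul_mem _ c hx

/-- A matrix `A` sending the cross-covariance matrix to `(I_r, 0)` extracts from the samples the
coefficient of `T ^ i a`, `i < r`, of every element of the orbit of `a`. -/
theorem sum_mul_inner_zpow_eq {r l s : ℕ} (hN : 0 < N) (hTN : (T ^ N) a = a)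
    {b : Fin s → H} {A : Matrix (Fin r) (Fin s × Fin l) ℂ}
    (hA : ∀ (i : Fin r) (k : Fin N),
      ∑ p : Fin s × Fin l, A i p * ⟪b p.1, (T ^ ((N : ℤ) + (k : ℤ) - (r : ℤ) * (p.2 : ℤ))) a⟫ =
        if (k : ℕ) = (i : ℕ) then 1 else 0) (i : Fin r) (k : ℤ) :
    ∑ p : Fin s × Fin l, A i p * ⟪b p.1, (T ^ (k - (r : ℤ) * (p.2 : ℤ))) a⟫ =
      if k % N = i then 1 else 0 := by
  have hN' : (0 : ℤ) < N := by exact_mod_cast hN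
  have h0 := Int.emod_nonneg k hN'.ne'
  have h1 := Int.emod_lt_of_pos k hN'
  have h := hA i ⟨(k % N).toNat, by omega⟩
  have hiff : ((k % N).toNat = (i : ℕ)) = (k % N = (i : ℤ)) := by
    apply propext; omega
  simp only [Int.toNat_of_nonneg h0, hiff] at h
  rw [← h]
  refine Finset.sum_congr rfl fun p _ => ?_
  congr 2
  have hk : (N : ℤ) + k % N - r * (p.2 : ℤ) = (k - r * (p.2 : ℤ)) + (1 - k / N) * N := by
    linear_combination Int.emod_add_mul_ediv k N
  rw [hk]
  have := (zpow_apply_periodic hTN).int_mul (1 - k / N) (k - r * (p.2 : ℤ))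
  exact this.symm

/-- The dual generator `c_j = ∑ A i (j, n) T ^ (i - r n) a` reconstructs the orbit of `a`. -/
theorem sum_inner_smul_zpow_eq {r l s : ℕ} (hN : 0 < N) (hrl : N = r * l) (hTN : (T ^ N) a = a)
    {b : Fin s → H} {A : Matrix (Fin r) (Fin s × Fin l) ℂ}
    (hA : ∀ (i : Fin r) (k : ℤ),
      ∑ p : Fin s × Fin l, A i p * ⟪b p.1, (T ^ (k - (r : ℤ) * (p.2 : ℤ))) a⟫ =
        if k % N = i then 1 else 0) (k : Fin N) :
    ∑ j : Fin s, ∑ q : Fin l, ⟪b j, (T ^ ((k : ℤ) - (r : ℤ) * (q : ℤ))) a⟫ •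
      (T ^ ((r : ℤ) * (q : ℤ)))
        (∑ i : Fin r, ∑ n : Fin l, A i (j, n) • (T ^ ((i : ℤ) - (r : ℤ) * (n : ℤ))) a) =
      (T ^ (k : ℕ)) a := by
  have hrlz : (N : ℤ) = r * l := by exact_mod_cast hrl
  have hr : 0 < r := Nat.pos_of_ne_zero fun h => by simp [h] at hrl; omega
  have shift (j : Fin s) (i : Fin r) (n : Fin l) :
      ∑ q : Fin l, ⟪b j, (T ^ ((k : ℤ) - (r : ℤ) * (q : ℤ))) a⟫ •
        (T ^ ((i : ℤ) + (r : ℤ) * ((q : ℤ) - (n : ℤ)))) a =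
      ∑ m : Fin l, ⟪b j, (T ^ ((k : ℤ) - (r : ℤ) * (m : ℤ) - (r : ℤ) * (n : ℤ))) a⟫ •
        (T ^ ((i : ℤ) + (r : ℤ) * (m : ℤ))) a := by
    have hper : Function.Periodic (fun q : ℤ => ⟪b j, (T ^ ((k : ℤ) - (r : ℤ) * q)) a⟫ •
        (T ^ ((i : ℤ) + (r : ℤ) * (q - (n : ℤ)))) a) (l : ℤ) := fun q => by
      have h1 := (zpow_apply_periodic hTN).sub_eq ((k : ℤ) - r * q)
      have h2 := zpow_apply_periodic hTN ((i : ℤ) + r * (q - (n : ℤ)))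
      have e1 : (k : ℤ) - r * (q + l) = (k : ℤ) - r * q - N := by rw [hrlz]; ring
      have e2 : (i : ℤ) + r * (q + l - (n : ℤ)) = (i : ℤ) + r * (q - (n : ℤ)) + N := by
        rw [hrlz]; ring
      simp only at h1 h2 ⊢
      rw [e1, e2, h1, h2]
    have h := hper.sum_range_add (n : ℤ)
    rw [← Fin.sum_univ_eq_sum_range (fun m : ℕ => ⟪b j, (T ^ ((k : ℤ) - (r : ℤ) * (m : ℤ))) a⟫ •
        (T ^ ((i : ℤ) + (r : ℤ) * ((m : ℤ) - (n : ℤ)))) a),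
      ← Fin.sum_univ_eq_sum_range (fun m : ℕ =>
        ⟪b j, (T ^ ((k : ℤ) - (r : ℤ) * ((m : ℤ) + (n : ℤ)))) a⟫ •
        (T ^ ((i : ℤ) + (r : ℤ) * ((m : ℤ) + (n : ℤ) - (n : ℤ)))) a)] at h
    rw [← h]
    refine Finset.sum_congr rfl fun m _ => ?_
    rw [add_sub_cancel_right, mul_add, sub_sub]
  have hind (i : Fin r) (m : Fin l) :
      (((k : ℤ) - r * (m : ℤ)) % N = i) ↔ (k : ℤ) = i + r * (m : ℤ) := by
    have hm : (m : ℤ) + 1 ≤ l := by exact_mod_cast m.2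
    have hi : (i : ℤ) < r := by exact_mod_cast i.2
    have hk : (k : ℤ) < N := by exact_mod_cast k.2
    have hub : (i : ℤ) + r * (m : ℤ) < N := by nlinarith
    have hlb : (0 : ℤ) ≤ r * (m : ℤ) := by positivity
    constructor
    · intro h
      have h1 := Int.emod_add_mul_ediv ((k : ℤ) - r * (m : ℤ)) N
      rw [h] at h1
      have hz : ((k : ℤ) - r * (m : ℤ)) / N = 0 := by
        by_contra hne
        rcases lt_or_gt_of_ne hne with hlt | hgt
        · nlinarith [Int.natCast_nonneg (k : ℕ)]
        · nlinarith
      rw [hz] at h1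
      linarith
    · intro h
      rw [h, add_sub_cancel_right]
      exact Int.emod_eq_of_lt (by positivity) (by linarith)
  calc
    _ = ∑ j : Fin s, ∑ q : Fin l, ∑ i : Fin r, ∑ n : Fin l, A i (j, n) •
          ⟪b j, (T ^ ((k : ℤ) - (r : ℤ) * (q : ℤ))) a⟫ •
            (T ^ ((i : ℤ) + (r : ℤ) * ((q : ℤ) - (n : ℤ)))) a := by
      refine Finset.sum_congr rfl fun j _ => Finset.sum_congr rfl fun q _ => ?_
      simp only [map_sum, map_smul, Finset.smul_sum, T.zpow_apply_add]
      refine Finset.sum_congr rfl fun i _ => Finset.sum_congr rfl fun n _ => ?_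
      rw [smul_comm]
      congr 4; ring
    _ = ∑ i : Fin r, ∑ j : Fin s, ∑ n : Fin l, A i (j, n) • ∑ q : Fin l,
          ⟪b j, (T ^ ((k : ℤ) - (r : ℤ) * (q : ℤ))) a⟫ •
            (T ^ ((i : ℤ) + (r : ℤ) * ((q : ℤ) - (n : ℤ)))) a := by
      rw [Finset.sum_comm' (t' := Finset.univ) (s' := fun _ => Finset.univ) (by simp)]
      simp only [Finset.smul_sum]
      rw [Finset.sum_comm]
      rw [Finset.sum_comm (s := (Finset.univ : Finset (Fin r)))]
      refine Finset.sum_congr rfl fun j _ => ?_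
      rw [Finset.sum_comm]
      exact Finset.sum_congr rfl fun i _ => Finset.sum_comm
    _ = ∑ i : Fin r, ∑ m : Fin l, (∑ p : Fin s × Fin l,
          A i p * ⟪b p.1, (T ^ ((k : ℤ) - (r : ℤ) * (m : ℤ) - (r : ℤ) * (p.2 : ℤ))) a⟫) •
            (T ^ ((i : ℤ) + (r : ℤ) * (m : ℤ))) a := by
      simp only [shift, Finset.smul_sum, Finset.sum_smul, mul_smul]
      refine Finset.sum_congr rfl fun i _ => ?_
      rw [Finset.sum_comm (s := (Finset.univ : Finset (Fin l))), Fintype.sum_prod_type]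
    _ = ∑ i : Fin r, ∑ m : Fin l, if (k : ℤ) = i + r * (m : ℤ) then (T ^ (k : ℕ)) a else 0 := by
      refine Finset.sum_congr rfl fun i _ => Finset.sum_congr rfl fun m _ => ?_
      rw [hA, ite_smul, one_smul, zero_smul]
      simp only [hind]
      split_ifs with h
      · rw [← h, zpow_natCast]
      · rfl
    _ = (T ^ (k : ℕ)) a := by
      let i₀ : Fin r := ⟨k % r, Nat.mod_lt _ hr⟩
      let m₀ : Fin l := ⟨k / r, Nat.div_lt_of_lt_mul (hrl ▸ k.2)⟩
      have huniq (i : Fin r) (m : Fin l) :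
          ((k : ℤ) = i + r * (m : ℤ)) ↔ (i, m) = (i₀, m₀) := by
        have hnat : ((k : ℤ) = i + r * (m : ℤ)) ↔ (k : ℕ) = i + r * m := by exact_mod_cast Iff.rfl
        rw [hnat, Prod.mk.injEq, Fin.ext_iff, Fin.ext_iff]
        constructor
        · intro h
          simp only [i₀, m₀, h, Nat.add_mul_mod_self_left, Nat.mod_eq_of_lt i.2,
            Nat.add_mul_div_left _ _ hr, Nat.div_eq_of_lt i.2, zero_add, and_self]
        · rintro ⟨h1, h2⟩
          rw [h1, h2]
          exact (Nat.mod_add_div _ _).symm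
      simp only [huniq]
      rw [← Fintype.sum_prod_type (fun p : Fin r × Fin l =>
        if p = (i₀, m₀) then (T ^ (k : ℕ)) a else 0)]
      simp

end Orbit

/-- **Theorem 4.1 of the paper.**  Cyclic single-generator setting:
`T^N a = a`, `{Tᵏa}_{k<N}` linearly independent and spanning `𝒜_a`, `b_j ∈ H`,
`N = rℓ`, samples `𝓛_j x(rn) = ⟨x, (T*)^{-rn} b_j⟩`, and `ℝ_{a,b}` the `sℓ×N`
block matrix with `r`-circulant `ℓ×N` blocks built from `r_{a,b_j}(k) = ⟨Tᵏ a, b_j⟩`.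
The following are equivalent:
(a) `rank ℝ_{a,b} = N`;
(b) there is an `r×sℓ` matrix `𝕊` with `𝕊 ℝ_{a,b} = (I_r, 0_{r×(N−r)})`;
(c) there are `c_j ∈ 𝒜_a` with `{T^{rn}c_j}` a frame (spanning set) for `𝒜_a` and
`x = ∑_j ∑_n 𝓛_j x(rn) T^{rn} c_j` for every `x ∈ 𝒜_a`;
(d) there is a frame `{C_{j,n}}` for `𝒜_a` with `x = ∑_j ∑_n 𝓛_j x(rn) C_{j,n}`.
(The paper's inner product `⟨u,v⟩`, linear in the first slot, is Mathlib's `⟪v,u⟫_ℂ`;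
`S` denotes the adjoint `T*`.) -/
theorem stmt_14 {H : Type*} [NormedAddCommGroup H] [InnerProductSpace ℂ H] [CompleteSpace H]
    (T S : H ≃L[ℂ] H)
    (hS : ∀ x y : H, ⟪T x, y⟫ = ⟪x, S y⟫)
    (N r ℓ s : ℕ) (hN : 0 < N) (hr : 0 < r) (hs : 0 < s) (hrl : N = r * ℓ)
    (a : H) (b : Fin s → H)
    (hTN : (T ^ N) a = a)
    (hind : LinearIndependent ℂ fun k : Fin N => (T ^ (k : ℕ)) a) :
    let rab : Fin s → ℤ → ℂ := fun j k => ⟪b j, (T ^ k) a⟫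
    let R : Matrix (Fin s × Fin ℓ) (Fin N) ℂ :=
      Matrix.of fun p k => rab p.1 ((N : ℤ) + (k : ℤ) - (r : ℤ) * (p.2 : ℤ))
    let Aa := Submodule.span ℂ (Set.range fun k : Fin N => (T ^ (k : ℕ)) a)
    let L : H → Fin s → Fin ℓ → ℂ :=
      fun x j n => ⟪(S ^ (-((r : ℤ) * (n : ℤ)))) (b j), x⟫
    let PA := R.rank = N
    let PB := ∃ Sm : Matrix (Fin r) (Fin s × Fin ℓ) ℂ, ∀ (i : Fin r) (k : Fin N),
      (Sm * R) i k = if (k : ℕ) = (i : ℕ) then 1 else 0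
    let PC := ∃ c : Fin s → H, (∀ j, c j ∈ Aa) ∧
      Submodule.span ℂ
        (Set.range fun p : Fin s × Fin ℓ => (T ^ ((r : ℤ) * (p.2 : ℤ))) (c p.1)) = Aa ∧
      ∀ x ∈ Aa, x = ∑ j : Fin s, ∑ n : Fin ℓ, L x j n • (T ^ ((r : ℤ) * (n : ℤ))) (c j)
    let PD := ∃ C : Fin s → Fin ℓ → H, (∀ j n, C j n ∈ Aa) ∧
      Submodule.span ℂ (Set.range fun p : Fin s × Fin ℓ => C p.1 p.2) = Aa ∧
      ∀ x ∈ Aa, x = ∑ j : Fin s, ∑ n : Fin ℓ, L x j n • C j n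
    (PA ↔ PB) ∧ (PB ↔ PC) ∧ (PC ↔ PD) := by
  intro rab R Aa L PA PB PC PD
  have hL (x : H) (j : Fin s) (n : Fin ℓ) :
      L x j n = ⟪b j, (T ^ (-((r : ℤ) * (n : ℤ)))) x⟫ := by
    change ⟪(S ^ (-((r : ℤ) * (n : ℤ)))) (b j), x⟫ = _
    rw [← inner_conj_symm, ← inner_zpow_apply_eq hS, inner_conj_symm]
  have hLadd (x y : H) (j : Fin s) (n : Fin ℓ) : L (x + y) j n = L x j n + L y j n :=
    inner_add_right _ _ _
  have hLsmul (z : ℂ) (x : H) (j : Fin s) (n : Fin ℓ) : L (z • x) j n = z * L x j n :=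
    inner_smul_right _ _ _
  have hLorb (k : ℤ) (j : Fin s) (n : Fin ℓ) :
      L ((T ^ k) a) j n = ⟪b j, (T ^ (k - (r : ℤ) * (n : ℤ))) a⟫ := by
    rw [hL, T.zpow_apply_add]; congr 3; ring
  have hRL (p : Fin s × Fin ℓ) (k : Fin N) : R p k = L ((T ^ (k : ℕ)) a) p.1 p.2 := by
    rw [← zpow_natCast, hLorb]
    change ⟪b p.1, (T ^ ((N : ℤ) + (k : ℤ) - (r : ℤ) * (p.2 : ℤ))) a⟫ = _
    have h := zpow_apply_periodic hTN ((k : ℤ) - (r : ℤ) * (p.2 : ℤ))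
    simp only at h
    rw [← h]; congr 3; ring
  have hAB : PA → PB := by
    intro h
    obtain ⟨B, hB⟩ := Matrix.exists_mul_eq_one_of_rank_eq (A := R)
      (h.trans (Fintype.card_fin N).symm)
    have hℓ : 0 < ℓ := Nat.pos_of_ne_zero fun h => by simp [h] at hrl; omega
    have hrN : r ≤ N := hrl ▸ Nat.le_mul_of_pos_right r hℓ
    refine ⟨B.submatrix (Fin.castLE hrN) id, fun i k => ?_⟩
    have := congrFun (congrFun hB (Fin.castLE hrN i)) k
    rw [Matrix.one_apply] at this
    refine Eq.trans this (if_congr ?_ rfl rfl)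
    rw [Fin.ext_iff, eq_comm]
    rfl
  have hBC : PB → PC := by
    rintro ⟨A, hA⟩
    have hrec := sum_inner_smul_zpow_eq hN hrl hTN (sum_mul_inner_zpow_eq hN hTN hA)
    set c : Fin s → H := fun j =>
      ∑ i : Fin r, ∑ n : Fin ℓ, A i (j, n) • (T ^ ((i : ℤ) - (r : ℤ) * (n : ℤ))) a
    have hcmem (j : Fin s) : c j ∈ Aa :=
      Submodule.sum_mem _ fun i _ => Submodule.sum_mem _ fun n _ =>
        Submodule.smul_mem _ _ (zpow_apply_mem_span hN hTN _)
    have hx : ∀ x ∈ Aa,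
        x = ∑ j : Fin s, ∑ n : Fin ℓ, L x j n • (T ^ ((r : ℤ) * (n : ℤ))) (c j) := by
      intro x hx
      induction hx using Submodule.span_induction with
      | mem x h =>
        obtain ⟨k, rfl⟩ := h
        refine (hrec k).symm.trans ?_
        refine Finset.sum_congr rfl fun j _ => Finset.sum_congr rfl fun n _ => ?_
        change _ = L ((T ^ (k : ℕ)) a) j n • (T ^ ((r : ℤ) * (n : ℤ))) (c j)
        rw [← zpow_natCast T k, hLorb]
      | zero => simp [L]
      | add x y _ _ hx hy =>
        conv_lhs => rw [hx, hy]
        simp only [hLadd, add_smul, Finset.sum_add_distrib]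
      | smul z x _ hx =>
        conv_lhs => rw [hx]
        simp only [hLsmul, mul_smul, Finset.smul_sum]
    refine ⟨c, hcmem, le_antisymm ?_ fun x hxA => ?_, hx⟩
    · rw [Submodule.span_le]
      rintro _ ⟨p, rfl⟩
      exact zpow_apply_mem_of_mem_span hN hTN _ (hcmem _)
    · rw [hx x hxA]
      exact Submodule.sum_mem _ fun j _ => Submodule.sum_mem _ fun n _ =>
        Submodule.smul_mem _ _ (Submodule.subset_span ⟨(j, n), rfl⟩)
  have hCD : PC → PD := by
    rintro ⟨c, hc, hspan, hx⟩
    exact ⟨fun j n => (T ^ ((r : ℤ) * (n : ℤ))) (c j),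
      fun j n => zpow_apply_mem_of_mem_span hN hTN _ (hc j), hspan, hx⟩
  have hDA : PD → PA := by
    rintro ⟨C, -, -, hx⟩
    refine (Matrix.rank_eq_card_of_mulVec_eq_zero fun v hv => ?_).trans (Fintype.card_fin N)
    have hmem : ∑ k : Fin N, v k • (T ^ (k : ℕ)) a ∈ Aa :=
      Submodule.sum_mem _ fun k _ => Submodule.smul_mem _ _ (Submodule.subset_span ⟨k, rfl⟩)
    have hzero (j : Fin s) (n : Fin ℓ) : L (∑ k : Fin N, v k • (T ^ (k : ℕ)) a) j n = 0 := by
      refine Eq.trans ?_ (congrFun hv (j, n))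
      simp only [Matrix.mulVec, dotProduct, hRL, L, inner_sum, inner_smul_right]
      exact Finset.sum_congr rfl fun k _ => mul_comm _ _
    have h0 := hx _ hmem
    simp only [hzero, zero_smul, Finset.sum_const_zero] at h0
    exact funext (Fintype.linearIndependent_iff.mp hind v h0)
  exact ⟨⟨hAB, hDA ∘ hCD ∘ hBC⟩, ⟨hBC, hAB ∘ hDA ∘ hCD⟩, ⟨hCD, hBC ∘ hAB ∘ hDA⟩⟩
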